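/- arXiv:2204.00066 — 2 statements merged into one kernel-verified Lean document; each statement's English description precedes it below -/
import Mathlib

section
/- Let λ be a partition of n and let P_λ ∈ ℤ[x] be the polynomial such that P_λ(|F|) equals the number of strictly upper triangular n×n matrices over F of Jordan type λ for every finite field F. Then deg P_λ = Σ_{1 ≤ i < j ≤ N'} λ'_i λ'_j, where λ' is the dual partition and N' = λ₁. -/
open Polynomial

/-- `f` represents the partition `λ₁ ≥ λ₂ ≥ … ≥ λ_N > 0` of `n`:
`f i = λᵢ` for `1 ≤ i ≤ N` and `f i = 0` for `i > N`. -/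
def IsPartitionFun (f : ℕ → ℕ) (n N : ℕ) : Prop :=
  (∀ i j, i ≤ j → f j ≤ f i) ∧ (∀ i, 1 ≤ i → (0 < f i ↔ i ≤ N)) ∧
    ∑ i ∈ Finset.Icc 1 N, f i = n

/-- `A` is strictly upper triangular: `A i j = 0` whenever `j ≤ i`. -/
def StrictUpper {m : ℕ} {F : Type*} [Zero F] (A : Matrix (Fin m) (Fin m) F) : Prop :=
  ∀ i j : Fin m, (j : ℕ) ≤ (i : ℕ) → A i j = 0

/-- `A` has Jordan type `λ`: `rank (A ^ k) = Σᵢ max (λᵢ - k) 0` for every `k ≥ 0`. -/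
def HasJordanType {m : ℕ} {F : Type*} [Field F] (A : Matrix (Fin m) (Fin m) F)
    (f : ℕ → ℕ) (N : ℕ) : Prop :=
  ∀ k : ℕ, (A ^ k).rank = ∑ i ∈ Finset.Icc 1 N, (f i - k)

/-- The number of strictly upper triangular `m × m` matrices over `F` of Jordan type `λ`. -/
noncomputable def jordanCount (m : ℕ) (f : ℕ → ℕ) (N : ℕ)
    (F : Type) [Field F] [Fintype F] : ℕ :=
  Nat.card {A : Matrix (Fin m) (Fin m) F // StrictUpper A ∧ HasJordanType A f N}

/-- `dualPart f N j = λ'_j`, the number of parts of `λ` that are `≥ j`. -/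
def dualPart (f : ℕ → ℕ) (N j : ℕ) : ℕ :=
  ((Finset.Icc 1 N).filter fun i => j ≤ f i).card

/-- `alphaCount f N k = α_k`, the number of parts of `λ` equal to `k`. -/
def alphaCount (f : ℕ → ℕ) (N k : ℕ) : ℕ :=
  ((Finset.Icc 1 N).filter fun i => f i = k).card

/-- The rows containing a removable cell of the Young diagram of `λ`:
rows `1 ≤ i ≤ N` with `i = N` or `λ_{i+1} < λᵢ` (for `i = N` the condition
`f (i+1) < f i` holds automatically since `f (N+1) = 0 < f N`). -/
def removables (f : ℕ → ℕ) (N : ℕ) : Finset ℕ :=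
  (Finset.Icc 1 N).filter fun i => f (i + 1) < f i

/-- The block matrix `[[A, v], [0, 0]]`. -/
def borderMatrix {m : ℕ} {F : Type*} [Zero F] (A : Matrix (Fin m) (Fin m) F) (v : Fin m → F) :
    Matrix (Fin (m + 1)) (Fin (m + 1)) F :=
  Matrix.of fun i j =>
    (Fin.snoc (fun i' => (Fin.snoc (A i') (v i') : Fin (m + 1) → F) j) 0 : Fin (m + 1) → F) i

/-- The differences of consecutive ranks of powers of `A` are given by `c`. -/
def HasRankDrops {m : ℕ} {F : Type*} [Field F] (A : Matrix (Fin m) (Fin m) F) (c : ℕ → ℕ) : Prop :=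
  ∀ k, (A ^ k).rank = (A ^ (k + 1)).rank + c k

/-- The vectors `v` such that `A ^ k v` lies in the range of `A ^ (k + 1)`. -/
def liftable {m : ℕ} {F : Type*} [Field F] (A : Matrix (Fin m) (Fin m) F) (k : ℕ) :
    Submodule F (Fin m → F) :=
  (LinearMap.range (A ^ (k + 1)).mulVecLin).comap (A ^ k).mulVecLin

section Border

variable {m : ℕ} {F : Type*} [Field F]

theorem borderMatrix_inj {A A' : Matrix (Fin m) (Fin m) F} {v v' : Fin m → F}
    (h : borderMatrix A v = borderMatrix A' v') : A = A' ∧ v = v' := by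
  constructor
  · ext i j
    simpa [borderMatrix] using congrFun (congrFun h i.castSucc) j.castSucc
  · ext i
    simpa [borderMatrix] using congrFun (congrFun h i.castSucc) (Fin.last m)

theorem StrictUpper.borderMatrix {A : Matrix (Fin m) (Fin m) F} (hA : StrictUpper A)
    (v : Fin m → F) : StrictUpper (borderMatrix A v) := by
  intro i j hij
  induction i using Fin.lastCases with
  | last => simp [_root_.borderMatrix]
  | cast i =>
    induction j using Fin.lastCases with
    | last => simp at hij; omega
    | cast j => simpa [_root_.borderMatrix] using hA i j (by simpa using hij)

theorem StrictUpper.exists_eq_borderMatrix {B : Matrix (Fin (m + 1)) (Fin (m + 1)) F}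
    (hB : StrictUpper B) :
    ∃ A v, StrictUpper A ∧ B = _root_.borderMatrix A v := by
  refine ⟨Matrix.of fun i j => B i.castSucc j.castSucc, fun i => B i.castSucc (Fin.last m),
    fun i j hij => hB _ _ (by simpa using hij), ?_⟩
  ext i j
  induction i using Fin.lastCases with
  | last => simpa [_root_.borderMatrix] using hB (Fin.last m) j (by simpa using j.is_le)
  | cast i =>
    induction j using Fin.lastCases with
    | last => simp [_root_.borderMatrix]
    | cast j => simp [_root_.borderMatrix]

theorem borderMatrix_mulVec_snoc (A : Matrix (Fin m) (Fin m) F) (v y : Fin m → F) (t : F) :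
    (borderMatrix A v).mulVec (Fin.snoc y t : Fin (m + 1) → F) =
      (Fin.snoc (A.mulVec y + t • v) 0 : Fin (m + 1) → F) := by
  ext i
  induction i using Fin.lastCases with
  | last => simp [borderMatrix, Matrix.mulVec, dotProduct]
  | cast i => simp [borderMatrix, Matrix.mulVec, dotProduct, Fin.sum_univ_castSucc, mul_comm]

theorem borderMatrix_pow_mulVec_snoc (A : Matrix (Fin m) (Fin m) F) (v y : Fin m → F) (t : F)
    (k : ℕ) :
    (borderMatrix A v ^ (k + 1)).mulVec (Fin.snoc y t : Fin (m + 1) → F) =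
      (Fin.snoc ((A ^ (k + 1)).mulVec y + t • (A ^ k).mulVec v) 0 : Fin (m + 1) → F) := by
  induction k with
  | zero => simpa using borderMatrix_mulVec_snoc A v y t
  | succ k ih =>
    rw [pow_succ' _ (k + 1), ← Matrix.mulVec_mulVec, ih, borderMatrix_mulVec_snoc]
    simp [Matrix.mulVec_add, Matrix.mulVec_smul, pow_succ']

/-- Appending a zero coordinate, as a linear map. -/
def snocZero (m : ℕ) (F : Type*) [Field F] : (Fin m → F) →ₗ[F] (Fin (m + 1) → F) where
  toFun y := Fin.snoc y 0
  map_add' x y := by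
    ext i
    induction i using Fin.lastCases <;> simp
  map_smul' a y := by
    ext i
    induction i using Fin.lastCases <;> simp

theorem snocZero_injective : Function.Injective (snocZero m F) := by
  intro x y h
  ext i
  simpa [snocZero] using congrFun h i.castSucc

theorem range_borderMatrix_pow (A : Matrix (Fin m) (Fin m) F) (v : Fin m → F) (k : ℕ) :
    LinearMap.range (borderMatrix A v ^ (k + 1)).mulVecLin =
      (LinearMap.range (A ^ (k + 1)).mulVecLin ⊔ Submodule.span F {(A ^ k).mulVec v}).map
        (snocZero m F) := by
  ext x
  simp only [LinearMap.mem_range, Submodule.mem_map, Submodule.mem_sup,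
    Submodule.mem_span_singleton, Matrix.mulVecLin_apply]
  constructor
  · rintro ⟨z, rfl⟩
    rw [← Fin.snoc_init_self z, borderMatrix_pow_mulVec_snoc]
    exact ⟨_, ⟨_, ⟨Fin.init z, rfl⟩, _, ⟨z (Fin.last m), rfl⟩, rfl⟩, rfl⟩
  · rintro ⟨_, ⟨_, ⟨y, rfl⟩, _, ⟨t, rfl⟩, rfl⟩, rfl⟩
    exact ⟨Fin.snoc y t, borderMatrix_pow_mulVec_snoc A v y t k⟩

theorem mem_liftable {A : Matrix (Fin m) (Fin m) F} {v : Fin m → F} {k : ℕ} :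
    v ∈ liftable A k ↔ (A ^ k).mulVec v ∈ LinearMap.range (A ^ (k + 1)).mulVecLin := by
  simp [liftable]

theorem rank_borderMatrix_pow_of_mem {A : Matrix (Fin m) (Fin m) F} {v : Fin m → F} {k : ℕ}
    (h : v ∈ liftable A k) :
    (borderMatrix A v ^ (k + 1)).rank = (A ^ (k + 1)).rank := by
  rw [mem_liftable] at h
  rw [Matrix.rank, range_borderMatrix_pow, ← (Submodule.equivMapOfInjective _ snocZero_injective _).finrank_eq,
    sup_eq_left.2 (by simpa using h), Matrix.rank]

theorem rank_borderMatrix_pow_of_notMem {A : Matrix (Fin m) (Fin m) F} {v : Fin m → F} {k : ℕ}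
    (h : v ∉ liftable A k) :
    (borderMatrix A v ^ (k + 1)).rank = (A ^ (k + 1)).rank + 1 := by
  rw [mem_liftable] at h
  rw [Matrix.rank, range_borderMatrix_pow, ← (Submodule.equivMapOfInjective _ snocZero_injective _).finrank_eq,
    Submodule.finrank_sup_span_singleton h, Matrix.rank]

theorem liftable_mono (A : Matrix (Fin m) (Fin m) F) : Monotone (liftable A) := by
  refine monotone_nat_of_le_succ fun k v hv => ?_
  rw [mem_liftable, LinearMap.mem_range] at *
  obtain ⟨y, hy⟩ := hv
  refine ⟨y, ?_⟩
  rw [Matrix.mulVecLin_apply] at *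
  rw [pow_succ' _ (k + 1), ← Matrix.mulVec_mulVec, hy, Matrix.mulVec_mulVec, ← pow_succ']

theorem HasRankDrops.borderMatrix {A : Matrix (Fin m) (Fin m) F} {c : ℕ → ℕ}
    (hA : HasRankDrops A c) {v : Fin m → F} {K : ℕ} (hK : v ∈ liftable A K)
    (hlt : ∀ k < K, v ∉ liftable A k) :
    HasRankDrops (borderMatrix A v) (c + Pi.single K 1) := by
  have h1 : ∀ k, (_root_.borderMatrix A v ^ k).rank = (A ^ k).rank + if k ≤ K then 1 else 0 := by
    intro k
    cases k with
    | zero => simp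
    | succ k =>
      by_cases hk : k < K
      · rw [rank_borderMatrix_pow_of_notMem (hlt k hk), if_pos (by omega)]
      · rw [rank_borderMatrix_pow_of_mem (liftable_mono A (not_lt.1 hk) hK), if_neg (by omega), add_zero]
  intro k
  have := hA k
  rw [h1, h1, Pi.add_apply, Pi.single_apply]
  split_ifs <;> omega

theorem StrictUpper.pow_eq_zero {A : Matrix (Fin m) (Fin m) F} (hA : StrictUpper A) :
    A ^ m = 0 := by
  induction m with
  | zero => exact Subsingleton.elim _ _
  | succ m ih =>
    obtain ⟨A, v, hA', rfl⟩ := hA.exists_eq_borderMatrix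
    have h0 := ih hA'
    refine Matrix.mulVec_injective (funext fun x => ?_)
    rw [← Fin.snoc_init_self x, borderMatrix_pow_mulVec_snoc, pow_succ, h0]
    rw [Matrix.zero_mul, Matrix.zero_mulVec, Matrix.zero_mulVec, Matrix.zero_mulVec, smul_zero,
      add_zero]
    exact (snocZero m F).map_zero

theorem HasRankDrops.unique {A : Matrix (Fin m) (Fin m) F} {c c' : ℕ → ℕ}
    (h : HasRankDrops A c) (h' : HasRankDrops A c') : c = c' := by
  ext k
  have := h k
  have := h' k
  omega

theorem exists_hasRankDrops (A : Matrix (Fin m) (Fin m) F) : ∃ c, HasRankDrops A c := by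
  refine ⟨fun k => (A ^ k).rank - (A ^ (k + 1)).rank, fun k => ?_⟩
  have : (A ^ (k + 1)).rank ≤ (A ^ k).rank := by
    rw [pow_succ]
    exact Matrix.rank_mul_le_left _ _
  simp only
  omega

theorem HasRankDrops.le {A : Matrix (Fin m) (Fin m) F} {c : ℕ → ℕ} (h : HasRankDrops A c) (k : ℕ) :
    c k ≤ m := by
  have h1 := h k
  have h2 := (A ^ k).rank_le_width
  omega

theorem HasRankDrops.finrank_liftable {A : Matrix (Fin m) (Fin m) F} {c : ℕ → ℕ}
    (h : HasRankDrops A c) (k : ℕ) : Module.finrank F (liftable A k) = m - c k := by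
  have h1 := (A ^ k).mulVecLin.domRestrict (liftable A k) |>.finrank_range_add_finrank_ker
  have h2 := (A ^ k).mulVecLin.finrank_range_add_finrank_ker
  have h3 := h k
  have hle : LinearMap.range (A ^ (k + 1)).mulVecLin ≤ LinearMap.range (A ^ k).mulVecLin := by
    rw [pow_succ, Matrix.mulVecLin_mul]
    exact LinearMap.range_comp_le_range _ _
  have h4 : LinearMap.range ((A ^ k).mulVecLin.domRestrict (liftable A k)) =
      LinearMap.range (A ^ (k + 1)).mulVecLin := by
    rw [LinearMap.range_domRestrict, liftable, Submodule.map_comap_eq, inf_eq_right.2 hle]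
  have h5 : Module.finrank F (LinearMap.ker ((A ^ k).mulVecLin.domRestrict (liftable A k))) =
      Module.finrank F (LinearMap.ker (A ^ k).mulVecLin) := by
    rw [LinearMap.ker_domRestrict]
    refine (Submodule.comapSubtypeEquivOfLe fun v hv => ?_).finrank_eq
    rw [LinearMap.mem_ker] at hv
    rw [liftable, Submodule.mem_comap, hv]
    exact zero_mem _
  rw [h4, h5] at h1
  rw [Module.finrank_fin_fun] at h2
  simp only [Matrix.rank] at h3
  omega

end Border

/-- The strictly upper triangular matrices with rank drops `c`. -/
def rankDropSet (m : ℕ) (F : Type*) [Field F] (c : ℕ → ℕ) : Set (Matrix (Fin m) (Fin m) F) :=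
  {A | StrictUpper A ∧ HasRankDrops A c}

section Count

variable {m : ℕ} {F : Type*} [Field F]

theorem exists_borderMatrix_of_mem_rankDropSet {c : ℕ → ℕ}
    {B : Matrix (Fin (m + 1)) (Fin (m + 1)) F} (hB : B ∈ rankDropSet (m + 1) F c) :
    ∃ K c₀, c = c₀ + Pi.single K 1 ∧ ∃ A ∈ rankDropSet m F c₀, ∃ v ∈ liftable A K,
      B = borderMatrix A v := by
  classical
  obtain ⟨hB, hc⟩ := hB
  obtain ⟨A, v, hA, rfl⟩ := hB.exists_eq_borderMatrix
  obtain ⟨c₀, hc₀⟩ := exists_hasRankDrops A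
  have hex : ∃ K, v ∈ liftable A K := ⟨m, by simp [mem_liftable, hA.pow_eq_zero]⟩
  exact ⟨Nat.find hex, c₀, hc.unique (hc₀.borderMatrix (Nat.find_spec hex)
    fun k hk => Nat.find_min hex hk), A, ⟨hA, hc₀⟩, v, Nat.find_spec hex, rfl⟩

theorem HasRankDrops.ncard_liftable {A : Matrix (Fin m) (Fin m) F} {c : ℕ → ℕ}
    (h : HasRankDrops A c) (k : ℕ) :
    (liftable A k : Set (Fin m → F)).ncard = Nat.card F ^ (m - c k) := by
  rw [← h.finrank_liftable, ← Module.natCard_eq_pow_finrank (K := F)]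
  rfl

variable [Finite F]

theorem HasRankDrops.ncard_liftable_diff {A : Matrix (Fin m) (Fin m) F} {c : ℕ → ℕ}
    (h : HasRankDrops A c) (k : ℕ) :
    ((liftable A (k + 1) : Set (Fin m → F)) \ liftable A k).ncard =
      Nat.card F ^ (m - c (k + 1)) - Nat.card F ^ (m - c k) := by
  rw [Set.ncard_sdiff (liftable_mono A k.le_succ), h.ncard_liftable, h.ncard_liftable]

theorem ncard_borderMatrix (T : Set (Matrix (Fin m) (Fin m) F))
    (U : Matrix (Fin m) (Fin m) F → Set (Fin m → F)) (d : ℕ) (hU : ∀ A ∈ T, (U A).ncard = d) :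
    {B | ∃ A ∈ T, ∃ v ∈ U A, B = borderMatrix A v}.ncard = T.ncard * d := by
  have hrange : {B | ∃ A ∈ T, ∃ v ∈ U A, B = borderMatrix A v} =
      Set.range fun p : Σ A : T, U A => borderMatrix p.1.1 p.2.1 := by
    ext B
    constructor
    · rintro ⟨A, hA, v, hv, rfl⟩
      exact ⟨⟨⟨A, hA⟩, ⟨v, hv⟩⟩, rfl⟩
    · rintro ⟨p, rfl⟩
      exact ⟨p.1, p.1.2, p.2, p.2.2, rfl⟩
  have hinj : Function.Injective fun p : Σ A : T, U A => borderMatrix p.1.1 p.2.1 := by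
    rintro ⟨⟨A, hA⟩, ⟨v, hv⟩⟩ ⟨⟨A', hA'⟩, ⟨v', hv'⟩⟩ h
    obtain ⟨rfl, rfl⟩ := borderMatrix_inj h
    rfl
  have := Fintype.ofFinite T
  rw [hrange, ← Nat.card_coe_set_eq, Nat.card_range_of_injective hinj, Nat.card_sigma,
    Finset.sum_congr rfl fun (A : T) _ => (Nat.card_coe_set_eq (U A)).trans (hU A A.2)]
  rw [Finset.sum_const, Finset.card_univ, smul_eq_mul, ← Nat.card_eq_fintype_card,
    Nat.card_coe_set_eq]

/-- The second elementary symmetric function of `c 0, …, c (M - 1)`. -/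
def pairSum (M : ℕ) (c : ℕ → ℕ) : ℕ :=
  ∑ j ∈ Finset.range M, ∑ i ∈ Finset.range j, c i * c j

theorem two_mul_pairSum (M : ℕ) (c : ℕ → ℕ) :
    2 * pairSum M c + ∑ j ∈ Finset.range M, c j ^ 2 = (∑ j ∈ Finset.range M, c j) ^ 2 := by
  induction M with
  | zero => simp [pairSum]
  | succ M ih =>
    rw [pairSum, Finset.sum_range_succ, ← pairSum, Finset.sum_range_succ, Finset.sum_range_succ,
      ← Finset.sum_mul]
    linarith

theorem sum_add_single {M K : ℕ} (hK : K < M) (c : ℕ → ℕ) :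
    ∑ j ∈ Finset.range M, (c + Pi.single K 1 : ℕ → ℕ) j = ∑ j ∈ Finset.range M, c j + 1 := by
  simp [Finset.sum_add_distrib, Pi.single_apply, hK]

theorem pairSum_add_single {M K : ℕ} (hK : K < M) (c : ℕ → ℕ) :
    pairSum M (c + Pi.single K 1) + c K = pairSum M c + ∑ j ∈ Finset.range M, c j := by
  have h1 := two_mul_pairSum M (c + Pi.single K 1)
  have h2 := two_mul_pairSum M c
  rw [sum_add_single hK] at h1
  have h3 : ∑ j ∈ Finset.range M, (c + Pi.single K 1 : ℕ → ℕ) j ^ 2 =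
      ∑ j ∈ Finset.range M, c j ^ 2 + (2 * c K + 1) := by
    have : ∀ j, (c + Pi.single K 1 : ℕ → ℕ) j ^ 2 = c j ^ 2 + if j = K then 2 * c K + 1 else 0 := by
      intro j
      rw [Pi.add_apply, Pi.single_apply]
      split_ifs with h
      · subst h
        ring
      · simp
    rw [Finset.sum_congr rfl fun j _ => this j, Finset.sum_add_distrib]
    simp [hK]
  rw [h3] at h1
  linarith

theorem pow_pairSum_add_single {M K : ℕ} (hK : K < M) {c : ℕ → ℕ}
    (hsum : ∑ j ∈ Finset.range M, c j = m) (q : ℕ) :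
    q ^ pairSum M (c + Pi.single K 1) = q ^ pairSum M c * q ^ (m - c K) := by
  rw [← pow_add]
  congr 1
  have h1 := pairSum_add_single hK c
  have h2 : c K ≤ ∑ j ∈ Finset.range M, c j :=
    Finset.single_le_sum (f := c) (fun _ _ => Nat.zero_le _) (Finset.mem_range.2 hK)
  omega

theorem ncard_rankDropSet_le (M m : ℕ) (c : ℕ → ℕ) (hc : ∀ j, M ≤ j → c j = 0)
    (hsum : ∑ j ∈ Finset.range M, c j = m) :
    (rankDropSet m F c).ncard ≤ M ^ m * Nat.card F ^ pairSum M c := by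
  induction m generalizing c with
  | zero =>
    calc (rankDropSet 0 F c).ncard ≤ 1 := Set.ncard_le_one_of_subsingleton _
      _ ≤ M ^ 0 * Nat.card F ^ pairSum M c := by
        simpa using Nat.one_le_pow _ _ Nat.card_pos
  | succ m ih =>
    let c₀ : ℕ → ℕ → ℕ := fun K j => c j - (Pi.single K 1 : ℕ → ℕ) j
    let S : ℕ → Set (Matrix (Fin (m + 1)) (Fin (m + 1)) F) := fun K =>
      {B | ∃ A ∈ rankDropSet m F (c₀ K), ∃ v ∈ (liftable A K : Set (Fin m → F)),
        B = borderMatrix A v}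
    let I := (Finset.range M).filter fun K => c K ≠ 0
    have hsub : rankDropSet (m + 1) F c ⊆ ⋃ K ∈ I, S K := by
      intro B hB
      obtain ⟨K, d, rfl, h⟩ := exists_borderMatrix_of_mem_rankDropSet hB
      have hKc : (d + Pi.single K 1 : ℕ → ℕ) K ≠ 0 := by simp
      have hd : c₀ K = d := by
        ext j
        simp [c₀]
      refine Set.mem_biUnion (x := K) ?_ ?_
      · refine Finset.mem_filter.2 ⟨Finset.mem_range.2 ?_, hKc⟩
        by_contra hM
        exact hKc (hc K (not_lt.1 hM))
      · rw [← hd] at h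
        exact h
    have hS : ∀ K ∈ I, (S K).ncard ≤ M ^ m * Nat.card F ^ pairSum M c := by
      intro K hK
      obtain ⟨hKM, hK0⟩ := Finset.mem_filter.1 hK
      rw [Finset.mem_range] at hKM
      have hceq : c = c₀ K + Pi.single K 1 := by
        ext j
        simp only [c₀, Pi.add_apply, Pi.single_apply]
        split_ifs with h
        · subst h
          omega
        · simp
      have hsum₀ : ∑ j ∈ Finset.range M, c₀ K j = m := by
        have := sum_add_single hKM (c₀ K)
        rw [← hceq] at this
        omega
      have hc₀ : ∀ j, M ≤ j → c₀ K j = 0 := fun j hj => by simp [c₀, hc j hj]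
      calc (S K).ncard = (rankDropSet m F (c₀ K)).ncard * Nat.card F ^ (m - c₀ K K) :=
            ncard_borderMatrix _ _ _ fun A hA => hA.2.ncard_liftable K
        _ ≤ M ^ m * Nat.card F ^ pairSum M (c₀ K) * Nat.card F ^ (m - c₀ K K) :=
            Nat.mul_le_mul_right _ (ih _ hc₀ hsum₀)
        _ = M ^ m * Nat.card F ^ pairSum M c := by
            conv_rhs => rw [hceq, pow_pairSum_add_single hKM hsum₀]
            ring
    calc (rankDropSet (m + 1) F c).ncard ≤ (⋃ K ∈ I, S K).ncard :=
          Set.ncard_le_ncard hsub (Set.toFinite _)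
      _ ≤ ∑ K ∈ I, (S K).ncard := Finset.set_ncard_biUnion_le _ _
      _ ≤ I.card • (M ^ m * Nat.card F ^ pairSum M c) := Finset.sum_le_card_nsmul _ _ _ hS
      _ ≤ M * (M ^ m * Nat.card F ^ pairSum M c) := by
          rw [smul_eq_mul]
          refine Nat.mul_le_mul_right _ ?_
          simpa [I] using Finset.card_filter_le (Finset.range M) fun K => c K ≠ 0
      _ = M ^ (m + 1) * Nat.card F ^ pairSum M c := by ring

theorem HasRankDrops.le_two_mul_ncard {A : Matrix (Fin m) (Fin m) F} {c : ℕ → ℕ}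
    (h : HasRankDrops A c) {k : ℕ} (hlt : c (k + 1) < c k) :
    Nat.card F ^ (m - c (k + 1)) ≤
      2 * ((liftable A (k + 1) : Set (Fin m → F)) \ liftable A k).ncard := by
  rw [h.ncard_liftable_diff]
  have h1 : m - c (k + 1) = (m - c k) + (c k - c (k + 1) - 1) + 1 := by
    have := h.le k
    omega
  have h2 : 2 * Nat.card F ^ (m - c k) ≤ Nat.card F ^ (m - c (k + 1)) := by
    rw [h1, pow_succ, mul_comm]
    exact Nat.mul_le_mul (Nat.pow_le_pow_right Nat.card_pos (Nat.le_add_right _ _))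
      Finite.one_lt_card
  omega

theorem le_ncard_rankDropSet (M m : ℕ) (c : ℕ → ℕ) (hanti : Antitone c)
    (hc : ∀ j, M ≤ j → c j = 0) (hsum : ∑ j ∈ Finset.range M, c j = m) :
    Nat.card F ^ pairSum M c ≤ 2 ^ m * (rankDropSet m F c).ncard := by
  induction m generalizing c with
  | zero =>
    have hc0 : c = 0 := by
      ext j
      by_cases hj : j < M
      · exact Finset.sum_eq_zero_iff.1 hsum j (Finset.mem_range.2 hj)
      · exact hc j (not_lt.1 hj)
    have hmem : (0 : Matrix (Fin 0) (Fin 0) F) ∈ rankDropSet 0 F c :=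
      ⟨fun i => i.elim0, fun k => by
        rw [hc0, Subsingleton.elim ((0 : Matrix (Fin 0) (Fin 0) F) ^ k) (0 ^ (k + 1))]; simp⟩
    have : 0 < (rankDropSet 0 F c).ncard := (Set.ncard_pos (Set.toFinite _)).2 ⟨_, hmem⟩
    simp only [hc0, pairSum] at *
    simpa [Nat.one_le_iff_ne_zero, Nat.pos_iff_ne_zero] using this
  | succ m ih =>
    classical
    have hex : ∃ K, c (K + 1) = 0 := ⟨M, hc _ (Nat.le_succ _)⟩
    obtain ⟨K, hK1, hKmin⟩ : ∃ K, c (K + 1) = 0 ∧ ∀ k < K, c (k + 1) ≠ 0 :=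
      ⟨Nat.find hex, Nat.find_spec hex, fun k hk => Nat.find_min hex hk⟩
    have hK0 : c K ≠ 0 := by
      intro h0
      rcases Nat.eq_zero_or_pos K with hK | hK
      · have : ∀ j, c j = 0 := fun j => Nat.le_zero.1 (h0 ▸ hanti (hK ▸ Nat.zero_le j))
        simp [this] at hsum
      · refine hKmin (K - 1) (by omega) ?_
        rwa [Nat.sub_add_cancel hK]
    have hKM : K < M := by
      by_contra hM
      exact hK0 (hc K (not_lt.1 hM))
    obtain ⟨d, rfl⟩ : ∃ d : ℕ → ℕ, c = d + Pi.single K 1 := by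
      refine ⟨fun j => c j - (Pi.single K 1 : ℕ → ℕ) j, ?_⟩
      ext j
      simp only [Pi.add_apply, Pi.single_apply]
      split_ifs with h
      · subst h
        omega
      · simp
    have hval : ∀ j, (d + Pi.single K 1 : ℕ → ℕ) j = d j + if j = K then 1 else 0 := fun j => by
      rw [Pi.add_apply, Pi.single_apply]
    have hd : Antitone d := by
      refine antitone_nat_of_succ_le fun j => ?_
      have h1 := hanti j.le_succ
      rw [hval, hval, Nat.succ_eq_add_one] at h1
      rw [hval] at hK1
      by_cases hj : j = K
      · subst hj
        omega
      · rw [if_neg hj] at h1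
        omega
    have hsumd : ∑ j ∈ Finset.range M, d j = m := by
      rw [sum_add_single hKM] at hsum
      omega
    have hdc : ∀ j, M ≤ j → d j = 0 := fun j hj => by
      have := hc j hj
      rw [hval] at this
      omega
    obtain ⟨U, D, hU, hUD, hUK⟩ : ∃ (U : Matrix (Fin m) (Fin m) F → Set (Fin m → F)) (D : ℕ),
        (∀ A ∈ rankDropSet m F d, (U A).ncard = D) ∧
        (∀ A ∈ rankDropSet m F d, Nat.card F ^ (m - d K) ≤ 2 * (U A).ncard) ∧
        ∀ A, ∀ v ∈ U A, v ∈ liftable A K ∧ ∀ k < K, v ∉ liftable A k := by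
      rcases K with _ | k
      · refine ⟨fun A => liftable A 0, _, fun A hA => hA.2.ncard_liftable 0, fun A hA => ?_,
          fun A v hv => ⟨hv, fun k hk => absurd hk (Nat.not_lt_zero k)⟩⟩
        rw [hA.2.ncard_liftable 0]
        omega
      · have hlt : d (k + 1) < d k := by
          have h1 := hanti k.le_succ
          rw [hval, hval, Nat.succ_eq_add_one] at h1
          simp at h1
          omega
        exact ⟨fun A => (liftable A (k + 1) : Set (Fin m → F)) \ liftable A k, _,
          fun A hA => hA.2.ncard_liftable_diff k, fun A hA => hA.2.le_two_mul_ncard hlt,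
          fun A v hv => ⟨hv.1, fun j hj hvj => hv.2 (liftable_mono A (Nat.lt_succ_iff.1 hj) hvj)⟩⟩
    have hsub : {B | ∃ A ∈ rankDropSet m F d, ∃ v ∈ U A, B = borderMatrix A v} ⊆
        rankDropSet (m + 1) F (d + Pi.single K 1) := by
      rintro _ ⟨A, hA, v, hv, rfl⟩
      exact ⟨hA.1.borderMatrix v, hA.2.borderMatrix (hUK A v hv).1 (hUK A v hv).2⟩
    have hne : (rankDropSet m F d).Nonempty := by
      refine Set.nonempty_of_ncard_ne_zero fun h0 => ?_
      have := ih d hd hdc hsumd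
      rw [h0, mul_zero, Nat.le_zero] at this
      exact pow_ne_zero _ Nat.card_pos.ne' this
    obtain ⟨A, hA⟩ := hne
    have hD : Nat.card F ^ (m - d K) ≤ 2 * D := hU A hA ▸ hUD A hA
    calc Nat.card F ^ pairSum M (d + Pi.single K 1)
        = Nat.card F ^ pairSum M d * Nat.card F ^ (m - d K) := pow_pairSum_add_single hKM hsumd _
      _ ≤ 2 ^ m * (rankDropSet m F d).ncard * (2 * D) := Nat.mul_le_mul (ih d hd hdc hsumd) hD
      _ = 2 ^ (m + 1) * ((rankDropSet m F d).ncard * D) := by ring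
      _ ≤ 2 ^ (m + 1) * (rankDropSet (m + 1) F (d + Pi.single K 1)).ncard := by
          rw [← ncard_borderMatrix _ U D hU]
          exact Nat.mul_le_mul_left _ (Set.ncard_le_ncard hsub (Set.toFinite _))

end Count

theorem natDegree_eq_of_prime_bounds (P : Polynomial ℤ) (e a b : ℕ)
    (hlow : ∀ p : ℕ, p.Prime → (p : ℤ) ^ e ≤ a * P.eval (p : ℤ))
    (hup : ∀ p : ℕ, p.Prime → P.eval (p : ℤ) ≤ b * (p : ℤ) ^ e) : P.natDegree = e := by
  set Q : Polynomial ℝ := P.map (Int.castRingHom ℝ) with hQ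
  have hdeg : Q.natDegree = P.natDegree :=
    Polynomial.natDegree_map_eq_of_injective Int.cast_injective P
  have heval : ∀ p : ℕ, Q.eval (p : ℝ) = ((P.eval (p : ℤ) : ℤ) : ℝ) := fun p => by
    have h := Polynomial.eval_intCast_map (Int.castRingHom ℝ) P p
    rwa [Int.cast_natCast] at h
  have hlow' : ∀ p : ℕ, p.Prime → (p : ℝ) ^ e ≤ a * Q.eval (p : ℝ) := fun p hp => by
    rw [heval]
    exact_mod_cast hlow p hp
  have hup' : ∀ p : ℕ, p.Prime → Q.eval (p : ℝ) ≤ b * (p : ℝ) ^ e := fun p hp => by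
    rw [heval]
    exact_mod_cast hup p hp
  have hQ0 : Q ≠ 0 := by
    rintro h
    have := hlow' 2 Nat.prime_two
    rw [h, Polynomial.eval_zero, mul_zero] at this
    exact absurd this (not_le.2 (by positivity))
  have hfreq : ∃ᶠ p : ℕ in Filter.atTop, p.Prime :=
    Nat.frequently_atTop_iff_infinite.2 Nat.infinite_setOfPred_prime
  have hX : ∀ x : ℝ, (Polynomial.X ^ e : Polynomial ℝ).eval x = x ^ e := by simp
  rw [← hdeg]
  rcases lt_trichotomy Q.natDegree e with h | h | h
  · exfalso
    have hlim := (Polynomial.div_tendsto_atTop_zero_of_degree_lt Q (Polynomial.X ^ e) (by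
      rw [Polynomial.degree_X_pow, Polynomial.degree_eq_natDegree hQ0]
      exact_mod_cast h)).comp (tendsto_natCast_atTop_atTop (R := ℝ))
    have hev := (hlim.const_mul (a : ℝ)).eventually_lt_const (u := 1) (by simp)
    obtain ⟨p, hp, hlt⟩ := (hfreq.and_eventually hev).exists
    have hpos : (0 : ℝ) < (p : ℝ) ^ e := pow_pos (by exact_mod_cast hp.pos) e
    rw [Function.comp_apply, hX, ← mul_div_assoc, div_lt_one hpos] at hlt
    exact absurd (hlow' p hp) (not_le.2 hlt)
  · exact h
  · exfalso
    have hlim := (Polynomial.abs_div_tendsto_atTop_atTop_of_degree_gt Q (Polynomial.X ^ e) (by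
      rw [Polynomial.degree_X_pow, Polynomial.degree_eq_natDegree hQ0]
      exact_mod_cast h) (by simp)).comp (tendsto_natCast_atTop_atTop (R := ℝ))
    obtain ⟨p, hp, hlt⟩ := (hfreq.and_eventually (hlim.eventually_gt_atTop (b : ℝ))).exists
    have hpos : (0 : ℝ) < (p : ℝ) ^ e := pow_pos (by exact_mod_cast hp.pos) e
    have h1 := hlow' p hp
    have h2 : 0 ≤ Q.eval (p : ℝ) := by
      by_contra hneg
      have : (a : ℝ) * Q.eval (p : ℝ) ≤ 0 :=
        mul_nonpos_of_nonneg_of_nonpos (Nat.cast_nonneg a) (not_le.1 hneg).le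
      linarith
    rw [Function.comp_apply, hX, abs_of_nonneg (div_nonneg h2 hpos.le), lt_div_iff₀ hpos] at hlt
    exact absurd (hup' p hp) (not_le.2 hlt)

theorem sum_sub_eq_add_dualPart (f : ℕ → ℕ) (N k : ℕ) :
    ∑ i ∈ Finset.Icc 1 N, (f i - k) =
      ∑ i ∈ Finset.Icc 1 N, (f i - (k + 1)) + dualPart f N (k + 1) := by
  rw [dualPart, Finset.card_filter, ← Finset.sum_add_distrib]
  refine Finset.sum_congr rfl fun i _ => ?_
  split_ifs <;> omega

theorem hasJordanType_iff_hasRankDrops {n N : ℕ} {f : ℕ → ℕ} (hf : IsPartitionFun f n N)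
    {F : Type*} [Field F] (A : Matrix (Fin n) (Fin n) F) :
    HasJordanType A f N ↔ HasRankDrops A fun k => dualPart f N (k + 1) := by
  constructor
  · intro h k
    rw [h, h, sum_sub_eq_add_dualPart]
  · intro h k
    induction k with
    | zero => simp [hf.2.2]
    | succ k ih =>
      have h1 := h k
      have h2 := sum_sub_eq_add_dualPart f N k
      simp only at h1
      omega

theorem jordanCount_eq_ncard {n N : ℕ} {f : ℕ → ℕ} (hf : IsPartitionFun f n N)
    (F : Type) [Field F] [Fintype F] :
    jordanCount n f N F = (rankDropSet n F fun k => dualPart f N (k + 1)).ncard := by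
  rw [jordanCount, ← Nat.card_coe_set_eq]
  simp only [hasJordanType_iff_hasRankDrops hf]
  rfl

theorem dualPart_antitone (f : ℕ → ℕ) (N : ℕ) : Antitone (dualPart f N) := fun i j hij =>
  Finset.card_le_card fun x hx => by
    rw [Finset.mem_filter] at hx ⊢
    exact ⟨hx.1, hij.trans hx.2⟩

theorem dualPart_eq_zero {n N : ℕ} {f : ℕ → ℕ} (hf : IsPartitionFun f n N) {j : ℕ}
    (hj : f 1 < j) : dualPart f N j = 0 := by
  rw [dualPart, Finset.card_eq_zero, Finset.filter_eq_empty_iff]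
  intro i hi
  have := hf.1 1 i (Finset.mem_Icc.1 hi).1
  omega

theorem sum_dualPart {n N : ℕ} {f : ℕ → ℕ} (hf : IsPartitionFun f n N) :
    ∑ k ∈ Finset.range (f 1), dualPart f N (k + 1) = n := by
  have key : ∀ M, ∑ k ∈ Finset.range M, dualPart f N (k + 1) +
      ∑ i ∈ Finset.Icc 1 N, (f i - M) = n := by
    intro M
    induction M with
    | zero => simp [hf.2.2]
    | succ M ih =>
      rw [sum_sub_eq_add_dualPart] at ih
      rw [Finset.sum_range_succ]
      omega
  have h0 : ∑ i ∈ Finset.Icc 1 N, (f i - f 1) = 0 := Finset.sum_eq_zero fun i hi =>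
    Nat.sub_eq_zero_of_le (hf.1 1 i (Finset.mem_Icc.1 hi).1)
  have := key (f 1)
  omega

theorem pairSum_succ (M : ℕ) (c : ℕ → ℕ) :
    pairSum M (fun k => c (k + 1)) = ∑ j ∈ Finset.Icc 1 M, ∑ i ∈ Finset.Ico 1 j, c i * c j := by
  rw [pairSum, ← Finset.Ico_add_one_right_eq_Icc, Finset.sum_Ico_eq_sum_range]
  refine Finset.sum_congr (by simp) fun j _ => ?_
  rw [Finset.sum_Ico_eq_sum_range]
  refine Finset.sum_congr (by simp) fun i _ => ?_
  rw [add_comm 1, add_comm 1]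

theorem deg_P (n N : ℕ) (f : ℕ → ℕ) (hf : IsPartitionFun f n N)
    (P : Polynomial ℤ)
    (hP : ∀ (F : Type) [Field F] [Fintype F],
      (jordanCount n f N F : ℤ) = P.eval (Fintype.card F : ℤ)) :
    P.natDegree = ∑ j ∈ Finset.Icc 1 (f 1), ∑ i ∈ Finset.Ico 1 j,
      dualPart f N i * dualPart f N j := by
  rw [← pairSum_succ]
  have hanti : Antitone fun k => dualPart f N (k + 1) := fun i j hij =>
    dualPart_antitone f N (Nat.succ_le_succ hij)
  have hzero : ∀ j, f 1 ≤ j → dualPart f N (j + 1) = 0 := fun j hj =>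
    dualPart_eq_zero hf (Nat.lt_succ_of_le hj)
  have hcount : ∀ p : ℕ, ∀ _ : Fact p.Prime, P.eval (p : ℤ) =
      ((rankDropSet n (ZMod p) fun k => dualPart f N (k + 1)).ncard : ℤ) := fun p _ => by
    have h := hP (ZMod p)
    rw [ZMod.card, jordanCount_eq_ncard hf] at h
    exact h.symm
  refine natDegree_eq_of_prime_bounds P _ (2 ^ n) (f 1 ^ n) (fun p hp => ?_) fun p hp => ?_
  · have : Fact p.Prime := ⟨hp⟩
    have h := le_ncard_rankDropSet (F := ZMod p) (f 1) n _ hanti hzero (sum_dualPart hf)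
    rw [Nat.card_zmod] at h
    rw [hcount p this]
    exact_mod_cast h
  · have : Fact p.Prime := ⟨hp⟩
    have h := ncard_rankDropSet_le (F := ZMod p) (f 1) n _ hzero (sum_dualPart hf)
    rw [Nat.card_zmod] at h
    rw [hcount p this]
    exact_mod_cast h
end

section
/- Let λ be a partition of n and let P_λ ∈ ℤ[x] be the polynomial such that P_λ(|F|) equals the number of strictly upper triangular n×n matrices over F of Jordan type λ for every finite field F. Then the leading coefficient of P_λ equals the number of standard Young tableaux of shape λ (i.e., the dimension of the irreducible representation V_λ of the symmetric group 𝔖_n). -/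
open Polynomial

/-- The number of standard Young tableaux of shape `λ` (fillings of the Young diagram
of `λ` with `1, …, n` increasing along rows and columns). -/
noncomputable def sytCount (n : ℕ) (f : ℕ → ℕ) : ℕ :=
  Nat.card {T : ℕ × ℕ → ℕ //
    (∀ p : ℕ × ℕ, ¬(1 ≤ p.1 ∧ 1 ≤ p.2 ∧ p.2 ≤ f p.1) → T p = 0) ∧
    Set.BijOn T {p : ℕ × ℕ | 1 ≤ p.1 ∧ 1 ≤ p.2 ∧ p.2 ≤ f p.1} (Set.Icc 1 n) ∧
    (∀ i j, 1 ≤ i → 1 ≤ j → j + 1 ≤ f i → T (i, j) < T (i, j + 1)) ∧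
    (∀ i j, 1 ≤ i → 1 ≤ j → j ≤ f (i + 1) → T (i, j) < T (i + 1, j))}

/-- `f` restricted to the indices `1, …, M` is a partition of `n` into at most `M` parts. -/
structure IsBoundedPartition (f : ℕ → ℕ) (n M : ℕ) : Prop where
  anti : ∀ i j, i ≤ j → f j ≤ f i
  eq_zero : ∀ i, M < i → f i = 0
  sum_eq : ∑ i ∈ Finset.Icc 1 M, f i = n

lemma IsPartitionFun.isBoundedPartition {f : ℕ → ℕ} {n N : ℕ} (hf : IsPartitionFun f n N) :
    IsBoundedPartition f n N where
  anti := hf.1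
  eq_zero i hi := by
    have := hf.2.1 i (by omega)
    omega
  sum_eq := hf.2.2

/-- The partition obtained from `f` by removing the last cell of row `i`. -/
def removeCell (f : ℕ → ℕ) (i : ℕ) : ℕ → ℕ := Function.update f i (f i - 1)

lemma removeCell_apply (f : ℕ → ℕ) (i k : ℕ) :
    removeCell f i k = if k = i then f i - 1 else f k := by
  simp [removeCell, Function.update_apply]

/-- `∑ max (λᵢ - k) 0`, the rank of the `k`-th power of a nilpotent matrix of Jordan type `λ`. -/
def tailSum (f : ℕ → ℕ) (M k : ℕ) : ℕ := ∑ i ∈ Finset.Icc 1 M, (f i - k)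

/-- The length of the `(k + 1)`-st column of the Young diagram of `f`. -/
def colLength (f : ℕ → ℕ) (M k : ℕ) : ℕ := ((Finset.Icc 1 M).filter fun i => k < f i).card

lemma tailSum_eq_add_colLength (f : ℕ → ℕ) (M k : ℕ) :
    tailSum f M k = tailSum f M (k + 1) + colLength f M k := by
  rw [tailSum, tailSum, colLength, Finset.card_filter, ← Finset.sum_add_distrib]
  refine Finset.sum_congr rfl fun i _ => ?_
  split_ifs <;> omega

lemma mem_removables {f : ℕ → ℕ} {M i : ℕ} :
    i ∈ removables f M ↔ (1 ≤ i ∧ i ≤ M) ∧ f (i + 1) < f i := by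
  simp [removables]

lemma sum_removeCell {f : ℕ → ℕ} {M i : ℕ} (hi : i ∈ removables f M) (g : ℕ → ℕ → ℕ) :
    ∑ k ∈ Finset.Icc 1 M, g k (f k) + g i (f i - 1) =
      ∑ k ∈ Finset.Icc 1 M, g k (removeCell f i k) + g i (f i) := by
  rw [mem_removables] at hi
  have hm : i ∈ Finset.Icc 1 M := by simpa using hi.1
  rw [← Finset.sum_erase_add _ _ hm,
    ← Finset.sum_erase_add _ (fun k => g k (removeCell f i k)) hm]
  have : ∑ k ∈ (Finset.Icc 1 M).erase i, g k (removeCell f i k) =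
      ∑ k ∈ (Finset.Icc 1 M).erase i, g k (f k) := by
    refine Finset.sum_congr rfl fun k hk => ?_
    rw [removeCell_apply, if_neg (Finset.ne_of_mem_erase hk)]
  rw [this, removeCell_apply, if_pos rfl]
  ring

lemma tailSum_removeCell {f : ℕ → ℕ} {M i : ℕ} (hi : i ∈ removables f M) (k : ℕ) :
    tailSum f M k = tailSum (removeCell f i) M k + if k < f i then 1 else 0 := by
  have h := sum_removeCell hi fun _ x => x - k
  simp only [tailSum]
  split_ifs <;> omega

lemma eq_of_mem_removables {f : ℕ → ℕ} {M i j : ℕ} (hf : ∀ i j, i ≤ j → f j ≤ f i)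
    (hi : i ∈ removables f M) (hj : j ∈ removables f M) (h : f i = f j) : i = j := by
  rw [mem_removables] at hi hj
  rcases lt_trichotomy i j with hij | hij | hij
  · have := hf (i + 1) j hij
    omega
  · exact hij
  · have := hf (j + 1) i hij
    omega

namespace IsBoundedPartition

variable {f : ℕ → ℕ} {n M i : ℕ}

lemma removeCell (hf : IsBoundedPartition f (n + 1) M) (hi : i ∈ removables f M) :
    IsBoundedPartition (removeCell f i) n M where
  anti a b hab := by
    have h1 := hf.anti a b hab
    have h2 := (mem_removables.1 hi).2
    simp only [removeCell_apply]
    split_ifs with hb ha ha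
    · rfl
    · subst hb
      omega
    · subst ha
      have := hf.anti (a + 1) b (by omega)
      omega
    · exact h1
  eq_zero k hk := by
    have h1 := (mem_removables.1 hi).1
    rw [removeCell_apply, if_neg (by omega), hf.eq_zero k hk]
  sum_eq := by
    have h := sum_removeCell hi fun _ x => x
    have h2 := (mem_removables.1 hi).2
    have := hf.sum_eq
    omega

lemma exists_mem_removables (hf : IsBoundedPartition f n M) {c k : ℕ} (hk : 1 ≤ k)
    (hc : 0 < c) (hkc : f k = c) : ∃ i ∈ removables f M, f i = c := by
  have hM : ∀ a, f a = c → a ≤ M := fun a ha => by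
    by_contra h
    have := hf.eq_zero a (by omega)
    omega
  let s := (Finset.Icc 1 M).filter fun a => f a = c
  have hs : s.Nonempty := ⟨k, by simp [s, hkc, hk, hM k hkc]⟩
  have hmem := s.max'_mem hs
  set i := s.max' hs with hi
  simp only [s, Finset.mem_filter, Finset.mem_Icc] at hmem
  refine ⟨i, mem_removables.2 ⟨hmem.1, ?_⟩, hmem.2⟩
  refine lt_of_le_of_ne (hf.anti _ _ (Nat.le_succ i)) fun h => ?_
  have h1 : i + 1 ∈ s := by
    have := hM (i + 1) (by omega)
    simp only [s, Finset.mem_filter, Finset.mem_Icc]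
    omega
  have := s.le_max' _ h1
  omega

lemma removables_nonempty (hf : IsBoundedPartition f (n + 1) M) : (removables f M).Nonempty := by
  have h1 : 0 < f 1 := by
    by_contra h
    have : ∑ i ∈ Finset.Icc 1 M, f i = 0 := Finset.sum_eq_zero fun i hi => by
      have := hf.anti 1 i (Finset.mem_Icc.1 hi).1
      omega
    have := hf.sum_eq
    omega
  obtain ⟨i, hi, -⟩ := hf.exists_mem_removables le_rfl h1 rfl
  exact ⟨i, hi⟩

lemma colLength_le (hf : IsBoundedPartition f n M) (k : ℕ) : colLength f M k ≤ n := by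
  rw [colLength, Finset.card_filter, ← hf.sum_eq]
  refine Finset.sum_le_sum fun i _ => ?_
  split_ifs <;> omega

lemma colLength_removeCell (hf : IsBoundedPartition f n M) (hi : i ∈ removables f M) :
    colLength (_root_.removeCell f i) M (f i - 1) = i - 1 := by
  rw [mem_removables] at hi
  have : ((Finset.Icc 1 M).filter fun k => f i - 1 < _root_.removeCell f i k) =
      Finset.Ico 1 i := by
    ext k
    simp only [Finset.mem_filter, Finset.mem_Icc, Finset.mem_Ico, removeCell_apply]
    rcases lt_trichotomy k i with h | h | h
    · have := hf.anti k i h.le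
      simp only [h.ne, if_false]
      omega
    · simp [h]
    · have := hf.anti (i + 1) k h
      simp only [h.ne', if_false]
      omega
  rw [colLength, this, Nat.card_Ico]

lemma le_colLength_removeCell (hf : IsBoundedPartition f n M) (hi : i ∈ removables f M)
    (h2 : 2 ≤ f i) : i ≤ colLength (_root_.removeCell f i) M (f i - 2) := by
  rw [mem_removables] at hi
  have : Finset.Icc 1 i ⊆ (Finset.Icc 1 M).filter fun k => f i - 2 < _root_.removeCell f i k := by
    intro k hk
    simp only [Finset.mem_filter, Finset.mem_Icc, removeCell_apply] at hk ⊢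
    have := hf.anti k i hk.2
    split_ifs <;> omega
  simpa [colLength] using Finset.card_le_card this

end IsBoundedPartition

/-- The cells of the Young diagram of `f`, with 1-based coordinates. -/
def youngCells (f : ℕ → ℕ) : Set (ℕ × ℕ) := {p | 1 ≤ p.1 ∧ 1 ≤ p.2 ∧ p.2 ≤ f p.1}

/-- `T` is a standard Young tableau of shape `f`, extended by zero outside the diagram. -/
structure IsSYT (n : ℕ) (f : ℕ → ℕ) (T : ℕ × ℕ → ℕ) : Prop where
  eq_zero : ∀ p, p ∉ youngCells f → T p = 0
  bijOn : Set.BijOn T (youngCells f) (Set.Icc 1 n)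
  row_lt : ∀ i j, 1 ≤ i → 1 ≤ j → j + 1 ≤ f i → T (i, j) < T (i, j + 1)
  col_lt : ∀ i j, 1 ≤ i → 1 ≤ j → j ≤ f (i + 1) → T (i, j) < T (i + 1, j)

lemma sytCount_eq_card (n : ℕ) (f : ℕ → ℕ) : sytCount n f = Nat.card {T // IsSYT n f T} :=
  Nat.card_congr <| Equiv.subtypeEquivRight fun _ =>
    ⟨fun h => ⟨h.1, h.2.1, h.2.2.1, h.2.2.2⟩, fun h => ⟨h.1, h.2, h.3, h.4⟩⟩

lemma corner_mem_youngCells {f : ℕ → ℕ} {M i : ℕ} (hi : i ∈ removables f M) :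
    (i, f i) ∈ youngCells f := by
  rw [mem_removables] at hi
  simp only [youngCells, Set.mem_ofPred_eq]
  omega

lemma youngCells_removeCell {f : ℕ → ℕ} {M i : ℕ} (hi : i ∈ removables f M) :
    youngCells (removeCell f i) = youngCells f \ {(i, f i)} := by
  rw [mem_removables] at hi
  ext ⟨a, b⟩
  simp only [youngCells, removeCell_apply, Set.mem_ofPred_eq, Set.mem_sdiff,
    Set.mem_singleton_iff, Prod.mk.injEq]
  by_cases h : a = i
  · subst h
    simp only [if_true, true_and]
    omega
  · simp [h]

lemma Icc_one_succ_diff (n : ℕ) : Set.Icc 1 (n + 1) \ {n + 1} = Set.Icc 1 n := by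
  ext x
  simp only [Set.mem_sdiff, Set.mem_Icc, Set.mem_singleton_iff]
  omega

namespace IsSYT

variable {f : ℕ → ℕ} {n M i : ℕ} {T : ℕ × ℕ → ℕ}

lemma apply_le (hT : IsSYT n f T) (p : ℕ × ℕ) : T p ≤ n := by
  by_cases hp : p ∈ youngCells f
  · exact (hT.bijOn.mapsTo hp).2
  · simp [hT.eq_zero p hp]

lemma addCell (hi : i ∈ removables f M) (hT : IsSYT n (removeCell f i) T) :
    IsSYT (n + 1) f (Function.update T (i, f i) (n + 1)) := by
  have hc := youngCells_removeCell hi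
  have hmem := corner_mem_youngCells hi
  have hi' := mem_removables.1 hi
  refine ⟨fun p hp => ?_, ?_, fun a b ha hb hab => ?_, fun a b ha hb hab => ?_⟩
  · have hne : p ≠ (i, f i) := fun h => hp (h ▸ hmem)
    rw [Function.update_of_ne hne]
    exact hT.eq_zero p (by rw [hc]; exact fun h => hp h.1)
  · have h1 : Set.BijOn (Function.update T (i, f i) (n + 1)) (youngCells (removeCell f i))
        (Set.Icc 1 n) := by
      refine hT.bijOn.congr fun p hp => ?_
      rw [hc] at hp
      exact (Function.update_of_ne hp.2 _ _).symm
    have h2 := h1.insert (a := (i, f i)) (by simp)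
    rw [Function.update_self, hc, Set.insert_sdiff_singleton, Set.insert_eq_of_mem hmem,
      ← Icc_one_succ_diff n, Set.insert_sdiff_singleton, Set.insert_eq_of_mem (by simp)] at h2
    exact h2
  · have h1 : (a, b) ≠ (i, f i) := by
      rintro ⟨⟩
      omega
    rw [Function.update_of_ne h1]
    by_cases h2 : (a, b + 1) = (i, f i)
    · rw [h2, Function.update_self]
      exact Nat.lt_succ_of_le (hT.apply_le _)
    · rw [Function.update_of_ne h2]
      refine hT.row_lt a b ha hb ?_
      rw [removeCell_apply]
      split_ifs with h
      · subst h
        simp only [Prod.mk.injEq, true_and] at h2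
        omega
      · exact hab
  · have h1 : (a, b) ≠ (i, f i) := by
      rintro ⟨⟩
      omega
    rw [Function.update_of_ne h1]
    by_cases h2 : (a + 1, b) = (i, f i)
    · rw [h2, Function.update_self]
      exact Nat.lt_succ_of_le (hT.apply_le _)
    · rw [Function.update_of_ne h2]
      refine hT.col_lt a b ha hb ?_
      rw [removeCell_apply]
      split_ifs with h
      · subst h
        simp only [Prod.mk.injEq, true_and] at h2
        omega
      · exact hab

lemma removeCell (hi : i ∈ removables f M) (hT : IsSYT (n + 1) f T) (h : T (i, f i) = n + 1) :
    IsSYT n (removeCell f i) (Function.update T (i, f i) 0) := by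
  have hc := youngCells_removeCell hi
  have hmem := corner_mem_youngCells hi
  have hi' := mem_removables.1 hi
  have hle : ∀ k, _root_.removeCell f i k ≤ f k := fun k => by
    rw [removeCell_apply]
    split_ifs with hk
    · subst hk
      omega
    · rfl
  have hlt : ∀ b, b ≤ _root_.removeCell f i i → b < f i := fun b hb => by
    rw [removeCell_apply, if_pos rfl] at hb
    omega
  refine ⟨fun p hp => ?_, ?_, fun a b ha hb hab => ?_, fun a b ha hb hab => ?_⟩
  · by_cases hne : p = (i, f i)
    · rw [hne, Function.update_self]
    · rw [Function.update_of_ne hne]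
      exact hT.eq_zero p fun h => hp (by rw [hc]; exact ⟨h, hne⟩)
  · have h1 := hT.bijOn.sdiff_singleton hmem
    rw [h, Icc_one_succ_diff, ← hc] at h1
    refine h1.congr fun p hp => ?_
    rw [hc] at hp
    exact (Function.update_of_ne hp.2 _ _).symm
  · have h1 : (a, b) ≠ (i, f i) := by
      rintro ⟨⟩
      have := hlt _ hab
      omega
    have h2 : (a, b + 1) ≠ (i, f i) := by
      rintro h
      simp only [Prod.mk.injEq] at h
      obtain ⟨rfl, h⟩ := h
      have := hlt _ hab
      omega
    rw [Function.update_of_ne h1, Function.update_of_ne h2]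
    exact hT.row_lt a b ha hb (hab.trans (hle _))
  · have h1 : (a, b) ≠ (i, f i) := by
      rintro ⟨⟩
      have := hle (i + 1)
      omega
    have h2 : (a + 1, b) ≠ (i, f i) := by
      rintro h
      simp only [Prod.mk.injEq] at h
      obtain ⟨rfl, h⟩ := h
      have := hlt _ hab
      omega
    rw [Function.update_of_ne h1, Function.update_of_ne h2]
    exact hT.col_lt a b ha hb (hab.trans (hle _))

lemma exists_corner (hf : IsBoundedPartition f (n + 1) M) (hT : IsSYT (n + 1) f T) :
    ∃ i ∈ removables f M, T (i, f i) = n + 1 := by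
  obtain ⟨⟨i, j⟩, ⟨h1, h2, h3⟩, hp⟩ := hT.bijOn.surjOn (show n + 1 ∈ Set.Icc 1 (n + 1) by simp)
  simp only at h1 h2 h3
  have hj : j = f i := by
    by_contra hne
    have := hT.row_lt i j h1 h2 (by omega)
    have := hT.apply_le (i, j + 1)
    omega
  subst hj
  refine ⟨i, mem_removables.2 ⟨⟨h1, ?_⟩, ?_⟩, hp⟩
  · by_contra h
    have := hf.eq_zero i (by omega)
    omega
  · by_contra h
    have := hT.col_lt i (f i) h1 h2 (by omega)
    have := hT.apply_le (i + 1, f i)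
    omega

end IsSYT

/-- Inserting the largest entry of a standard Young tableau at a corner. -/
def sytOfCorner {f : ℕ → ℕ} {n M : ℕ}
    (x : Σ i : removables f M, {T // IsSYT n (removeCell f i) T}) : {T // IsSYT (n + 1) f T} :=
  ⟨Function.update x.2.1 (x.1, f x.1) (n + 1), x.2.2.addCell x.1.2⟩

lemma sytOfCorner_bijective {f : ℕ → ℕ} {n M : ℕ} (hf : IsBoundedPartition f (n + 1) M) :
    Function.Bijective (sytOfCorner (f := f) (n := n) (M := M)) := by
  constructor
  · rintro ⟨⟨i, hi⟩, S, hS⟩ ⟨⟨j, hj⟩, T, hT⟩ h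
    have h : Function.update S (i, f i) (n + 1) = Function.update T (j, f j) (n + 1) :=
      congrArg Subtype.val h
    obtain rfl : i = j := by
      by_contra hne
      have h1 := congrFun h (i, f i)
      have := hT.apply_le (i, f i)
      rw [Function.update_self, Function.update_of_ne (by simp [hne])] at h1
      omega
    obtain rfl : S = T := by
      funext p
      by_cases hp : p = (i, f i)
      · have hz : p ∉ youngCells (removeCell f i) := by
          simp [youngCells_removeCell hi, hp]
        rw [hS.eq_zero p hz, hT.eq_zero p hz]
      · have := congrFun h p
        rwa [Function.update_of_ne hp, Function.update_of_ne hp] at this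
    rfl
  · rintro ⟨T, hT⟩
    obtain ⟨i, hi, h⟩ := hT.exists_corner hf
    refine ⟨⟨⟨i, hi⟩, _, hT.removeCell hi h⟩, Subtype.ext ?_⟩
    simp [sytOfCorner, ← h]

lemma IsBoundedPartition.isSYT_zero_iff {f : ℕ → ℕ} {M : ℕ} (hf : IsBoundedPartition f 0 M)
    (T : ℕ × ℕ → ℕ) : IsSYT 0 f T ↔ T = 0 := by
  have hz : ∀ i, 1 ≤ i → f i = 0 := fun i hi => by
    rcases le_or_gt i M with h | h
    · exact Finset.sum_eq_zero_iff.1 hf.sum_eq i (Finset.mem_Icc.2 ⟨hi, h⟩)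
    · exact hf.eq_zero i h
  have hc : youngCells f = ∅ := by
    ext ⟨i, j⟩
    simp only [youngCells, Set.mem_ofPred_eq, Set.mem_empty_iff_false, iff_false]
    rintro ⟨h1, h2, h3⟩
    have := hz i h1
    omega
  constructor
  · intro h
    funext p
    exact h.eq_zero p (by simp [hc])
  · rintro rfl
    refine ⟨fun _ _ => rfl, by simp [hc], fun i j hi _ h => ?_, fun i j _ hj h => ?_⟩
    · have := hz i hi
      omega
    · have := hz (i + 1) (by omega)
      omega

lemma IsBoundedPartition.finite_isSYT {f : ℕ → ℕ} {n M : ℕ} (hf : IsBoundedPartition f n M) :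
    Finite {T // IsSYT n f T} := by
  induction n generalizing f with
  | zero =>
    simp only [hf.isSYT_zero_iff]
    infer_instance
  | succ n ih =>
    have (i : removables f M) := ih (hf.removeCell i.2)
    exact Finite.of_surjective _ (sytOfCorner_bijective hf).2

lemma IsBoundedPartition.sytCount_zero {f : ℕ → ℕ} {M : ℕ} (hf : IsBoundedPartition f 0 M) :
    sytCount 0 f = 1 := by
  rw [sytCount_eq_card]
  simp only [hf.isSYT_zero_iff]
  simp

lemma IsBoundedPartition.sytCount_succ {f : ℕ → ℕ} {n M : ℕ}
    (hf : IsBoundedPartition f (n + 1) M) :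
    sytCount (n + 1) f = ∑ i ∈ removables f M, sytCount n (_root_.removeCell f i) := by
  have (i : removables f M) := (hf.removeCell i.2).finite_isSYT
  rw [sytCount_eq_card, ← Nat.card_congr (Equiv.ofBijective _ (sytOfCorner_bijective hf)),
    Nat.card_sigma,
    ← Finset.sum_coe_sort _ fun i => sytCount n (_root_.removeCell f i)]
  simp only [sytCount_eq_card]

lemma IsBoundedPartition.sytCount_pos {f : ℕ → ℕ} {n M : ℕ} (hf : IsBoundedPartition f n M) :
    0 < sytCount n f := by
  induction n generalizing f with
  | zero => simp [hf.sytCount_zero]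
  | succ n ih =>
    rw [hf.sytCount_succ]
    exact Finset.sum_pos (fun i hi => ih (hf.removeCell hi)) hf.removables_nonempty

section LinearAlgebra

open Matrix Module

variable {F : Type*} [Field F] {n : ℕ}

/-- The vectors `v` with `A ^ k v` in the range of `A ^ (k + 1)`; this is `im A + ker A ^ k`. -/
def liftSpace (A : Matrix (Fin n) (Fin n) F) (k : ℕ) : Submodule F (Fin n → F) :=
  (LinearMap.range (A ^ (k + 1)).mulVecLin).comap (A ^ k).mulVecLin

lemma mem_liftSpace {A : Matrix (Fin n) (Fin n) F} {k : ℕ} {v : Fin n → F} :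
    v ∈ liftSpace A k ↔ (A ^ k) *ᵥ v ∈ LinearMap.range (A ^ (k + 1)).mulVecLin := Iff.rfl

lemma liftSpace_mono (A : Matrix (Fin n) (Fin n) F) : Monotone (liftSpace A) := by
  refine monotone_nat_of_le_succ fun k v hv => ?_
  rw [mem_liftSpace] at hv ⊢
  obtain ⟨u, hu⟩ := hv
  refine ⟨u, ?_⟩
  rw [mulVecLin_apply] at hu ⊢
  rw [pow_succ' A (k + 1), ← mulVec_mulVec, hu, mulVec_mulVec, ← pow_succ']

lemma finrank_liftSpace_add_rank (A : Matrix (Fin n) (Fin n) F) (k : ℕ) :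
    finrank F (liftSpace A k) + (A ^ k).rank = n + (A ^ (k + 1)).rank := by
  set g := (A ^ k).mulVecLin with hg
  set R := LinearMap.range (A ^ (k + 1)).mulVecLin with hR
  have hle : R ≤ LinearMap.range g := by
    rw [hR, hg, pow_succ, mulVecLin_mul]
    exact LinearMap.range_comp_le_range _ _
  have h1 := LinearMap.finrank_range_add_finrank_ker (g.domRestrict (liftSpace A k))
  have h2 : LinearMap.range (g.domRestrict (liftSpace A k)) = R := by
    rw [LinearMap.range_domRestrict]
    exact Submodule.map_comap_eq_of_le hle
  have h3 : finrank F (LinearMap.ker (g.domRestrict (liftSpace A k))) =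
      finrank F (LinearMap.ker g) := by
    rw [LinearMap.ker_domRestrict]
    refine (Submodule.comapSubtypeEquivOfLe fun v hv => ?_).finrank_eq
    rw [LinearMap.mem_ker] at hv
    change g v ∈ R
    rw [hv]
    exact R.zero_mem
  have h4 := LinearMap.finrank_range_add_finrank_ker g
  have h5 : finrank F (LinearMap.range g) = (A ^ k).rank := rfl
  have h6 : finrank F R = (A ^ (k + 1)).rank := rfl
  rw [finrank_fin_fun] at h4
  rw [h2, h3] at h1
  omega

open Classical in
lemma finrank_sup_span_singleton_ite {V : Type*} [AddCommGroup V] [Module F V]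
    [FiniteDimensional F V] (p : Submodule F V) (v : V) :
    finrank F ↥(p ⊔ Submodule.span F {v}) = finrank F p + if v ∈ p then 0 else 1 := by
  split_ifs with hv
  · rw [sup_of_le_left ((Submodule.span_singleton_le_iff_mem v p).2 hv), add_zero]
  · exact Submodule.finrank_sup_span_singleton hv

/-- The block matrix with blocks `A`, `v` in the first row and zeros in the second row. -/
def colBlock (A : Matrix (Fin n) (Fin n) F) (v : Fin n → F) :
    Matrix (Fin n ⊕ Fin 1) (Fin n ⊕ Fin 1) F :=
  fromBlocks A (replicateCol (Fin 1) v) 0 0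

lemma range_mulVecLin_colBlock (A : Matrix (Fin n) (Fin n) F) (v : Fin n → F) :
    LinearMap.range (colBlock A v).mulVecLin =
      (LinearMap.range A.mulVecLin ⊔ Submodule.span F {v}).map
        ((LinearEquiv.sumArrowLequivProdArrow (Fin n) (Fin 1) F F).symm.toLinearMap ∘ₗ
          LinearMap.inl F (Fin n → F) (Fin 1 → F)) := by
  ext y
  simp only [LinearMap.mem_range, Submodule.mem_map, Submodule.mem_sup,
    Submodule.mem_span_singleton, mulVecLin_apply, colBlock, fromBlocks_mulVec]
  constructor
  · rintro ⟨x, rfl⟩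
    refine ⟨_, ⟨_, ⟨x ∘ Sum.inl, rfl⟩, _, ⟨x (Sum.inr 0), rfl⟩, rfl⟩, ?_⟩
    ext (i | i) <;> simp [mulVec, dotProduct, mul_comm]
  · rintro ⟨_, ⟨_, ⟨x, rfl⟩, _, ⟨c, rfl⟩, rfl⟩, rfl⟩
    refine ⟨Sum.elim x fun _ => c, ?_⟩
    ext (i | i) <;> simp [mulVec, dotProduct, mul_comm]

open Classical in
lemma rank_colBlock (A : Matrix (Fin n) (Fin n) F) (v : Fin n → F) :
    (colBlock A v).rank =
      A.rank + if v ∈ LinearMap.range A.mulVecLin then 0 else 1 := by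
  have hinj : Function.Injective
      ((LinearEquiv.sumArrowLequivProdArrow (Fin n) (Fin 1) F F).symm.toLinearMap ∘ₗ
          LinearMap.inl F (Fin n → F) (Fin 1 → F)) := by
    rw [LinearMap.coe_comp]
    exact (LinearEquiv.injective _).comp LinearMap.inl_injective
  rw [rank, range_mulVecLin_colBlock, ← (Submodule.equivMapOfInjective _ hinj _).finrank_eq,
    finrank_sup_span_singleton_ite, rank]

lemma colBlock_pow (A : Matrix (Fin n) (Fin n) F) (v : Fin n → F) (k : ℕ) :
    (colBlock A v) ^ (k + 1) =
      colBlock (A ^ (k + 1)) (A ^ k *ᵥ v) := by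
  induction k with
  | zero => simp
  | succ k ih =>
    rw [pow_succ', ih, colBlock, colBlock, colBlock, fromBlocks_multiply,
      pow_succ' A (k + 1), pow_succ' A k,
      replicateCol_mulVec, replicateCol_mulVec]
    simp [Matrix.mul_assoc]

/-- The matrix obtained from `A` by appending the column `v` on the right and a zero row below. -/
def appendCol (A : Matrix (Fin n) (Fin n) F) (v : Fin n → F) :
    Matrix (Fin (n + 1)) (Fin (n + 1)) F :=
  reindex finSumFinEquiv finSumFinEquiv (colBlock A v)

lemma appendCol_castSucc_castSucc (A : Matrix (Fin n) (Fin n) F) (v : Fin n → F) (i j : Fin n) :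
    appendCol A v i.castSucc j.castSucc = A i j := by
  simp [appendCol, colBlock, Fin.castSucc]

lemma appendCol_castSucc_last (A : Matrix (Fin n) (Fin n) F) (v : Fin n → F) (i : Fin n) :
    appendCol A v i.castSucc (Fin.last n) = v i := by
  simp [appendCol, colBlock, Fin.castSucc, finSumFinEquiv_symm_last]

lemma appendCol_last (A : Matrix (Fin n) (Fin n) F) (v : Fin n → F) (j : Fin (n + 1)) :
    appendCol A v (Fin.last n) j = 0 := by
  rcases h : finSumFinEquiv.symm j with x | x <;>
    simp [appendCol, colBlock, finSumFinEquiv_symm_last, h]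

open Classical in
lemma rank_appendCol_pow_succ (A : Matrix (Fin n) (Fin n) F) (v : Fin n → F) (k : ℕ) :
    (appendCol A v ^ (k + 1)).rank =
      (A ^ (k + 1)).rank + if v ∈ liftSpace A k then 0 else 1 := by
  have : appendCol A v ^ (k + 1) = reindex finSumFinEquiv finSumFinEquiv
      (colBlock A v ^ (k + 1)) :=
    (map_pow (reindexAlgEquiv F F finSumFinEquiv) _ _).symm
  rw [this, rank_reindex, colBlock_pow, rank_colBlock]
  rfl

lemma strictUpper_appendCol (A : Matrix (Fin n) (Fin n) F) (v : Fin n → F) :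
    StrictUpper (appendCol A v) ↔ StrictUpper A := by
  constructor
  · intro h i j hij
    rw [← appendCol_castSucc_castSucc A v]
    exact h _ _ hij
  · intro h i j hij
    induction i using Fin.lastCases with
    | last => exact appendCol_last A v j
    | cast i =>
      induction j using Fin.lastCases with
      | last =>
        have := i.isLt
        simp only [Fin.val_last, Fin.val_castSucc] at hij
        omega
      | cast j =>
        rw [appendCol_castSucc_castSucc]
        exact h _ _ hij

lemma StrictUpper.appendCol_eq {B : Matrix (Fin (n + 1)) (Fin (n + 1)) F} (hB : StrictUpper B) :
    appendCol (B.submatrix Fin.castSucc Fin.castSucc) (fun i => B i.castSucc (Fin.last n)) =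
      B := by
  ext i j
  induction i using Fin.lastCases with
  | last => rw [appendCol_last, hB _ _ (Fin.le_last j)]
  | cast i =>
    induction j using Fin.lastCases with
    | last => rw [appendCol_castSucc_last]
    | cast j => rw [appendCol_castSucc_castSucc, submatrix_apply]

/-- A strictly upper triangular matrix of size `n + 1` is one of size `n` together with a column. -/
def strictUpperSuccEquiv (f : ℕ → ℕ) (M : ℕ) :
    {B : Matrix (Fin (n + 1)) (Fin (n + 1)) F // StrictUpper B ∧ HasJordanType B f M} ≃
      Σ A : Matrix (Fin n) (Fin n) F,
        {v : Fin n → F // StrictUpper A ∧ HasJordanType (appendCol A v) f M} where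
  toFun B := ⟨B.1.submatrix Fin.castSucc Fin.castSucc, fun i => B.1 i.castSucc (Fin.last n),
    (strictUpper_appendCol _ _).1 (B.2.1.appendCol_eq.symm ▸ B.2.1),
    B.2.1.appendCol_eq.symm ▸ B.2.2⟩
  invFun x := ⟨appendCol x.1 x.2.1, (strictUpper_appendCol _ _).2 x.2.2.1, x.2.2.2⟩
  left_inv B := Subtype.ext B.2.1.appendCol_eq
  right_inv := by
    rintro ⟨A, v, h1, h2⟩
    have hA : (appendCol A v).submatrix Fin.castSucc Fin.castSucc = A := by
      ext i j
      exact appendCol_castSucc_castSucc A v i j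
    have hv : (fun i => appendCol A v (Fin.castSucc i) (Fin.last n)) = v := by
      funext i
      exact appendCol_castSucc_last A v i
    exact Sigma.subtype_ext hA hv

lemma hasJordanType_iff {A : Matrix (Fin n) (Fin n) F} {f : ℕ → ℕ} {M : ℕ} :
    HasJordanType A f M ↔ ∀ k, (A ^ k).rank = tailSum f M k := Iff.rfl

lemma tailSum_zero (f : ℕ → ℕ) (M : ℕ) : tailSum f M 0 = ∑ i ∈ Finset.Icc 1 M, f i := by
  simp [tailSum]

lemma hasJordanType_appendCol_iff {f : ℕ → ℕ} {M : ℕ} (hf : IsBoundedPartition f (n + 1) M)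
    (A : Matrix (Fin n) (Fin n) F) (v : Fin n → F) :
    HasJordanType (appendCol A v) f M ↔ ∃ i ∈ removables f M,
      HasJordanType A (removeCell f i) M ∧ v ∈ liftSpace A (f i - 1) ∧
        ∀ j < f i - 1, v ∉ liftSpace A j := by
  classical
  have h0 : tailSum f M 0 = n + 1 := by rw [tailSum_zero, hf.sum_eq]
  constructor
  · intro h
    rw [hasJordanType_iff] at h
    have hex : ∃ k, v ∈ liftSpace A k := by
      refine ⟨f 1, ?_⟩
      by_contra hv
      have h1 := h (f 1 + 1)
      have h2 : tailSum f M (f 1 + 1) = 0 := Finset.sum_eq_zero fun i hi => by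
        have := hf.anti 1 i (Finset.mem_Icc.1 hi).1
        omega
      rw [rank_appendCol_pow_succ, if_neg hv] at h1
      omega
    set j := Nat.find hex with hj
    have hmem : ∀ k, v ∈ liftSpace A k ↔ j ≤ k := fun k =>
      ⟨fun hk => Nat.find_min' hex hk, fun hk => liftSpace_mono A hk (Nat.find_spec hex)⟩
    have hrank : ∀ k, (A ^ k).rank + (if k ≤ j then 1 else 0) = tailSum f M k := by
      rintro (_ | k)
      · simp [h0]
      · have := h (k + 1)
        rw [rank_appendCol_pow_succ, hmem] at this
        rw [← this]
        split_ifs <;> omega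
    have hcol : colLength f M (j + 1) < colLength f M j := by
      have h1 := finrank_liftSpace_add_rank A j
      have h2 := finrank_liftSpace_add_rank A (j + 1)
      have h3 := Submodule.finrank_mono (liftSpace_mono A (Nat.le_succ j))
      have r0 := hrank j
      have r1 := hrank (j + 1)
      have r2 := hrank (j + 2)
      rw [if_pos le_rfl] at r0
      rw [if_neg (by omega)] at r1 r2
      have t0 := tailSum_eq_add_colLength f M j
      have t1 := tailSum_eq_add_colLength f M (j + 1)
      simp only [add_assoc, Nat.reduceAdd, Nat.succ_eq_add_one] at *
      omega
    obtain ⟨k, hk1, hk2⟩ := Finset.exists_mem_notMem_of_card_lt_card hcol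
    simp only [Finset.mem_filter, not_and] at hk1 hk2
    have hk3 := hk2 hk1.1
    obtain ⟨i, hi, hfi⟩ := hf.exists_mem_removables (Finset.mem_Icc.1 hk1.1).1
      (Nat.succ_pos j) (by omega)
    refine ⟨i, hi, fun k => ?_, (hmem _).2 (by omega), fun k hk hv => ?_⟩
    · have h1 := hrank k
      have h2 := tailSum_removeCell hi k
      rw [hfi, Nat.succ_eq_add_one] at h2
      simp only [Nat.lt_succ_iff] at h2
      exact Nat.add_right_cancel (h1.trans h2)
    · have := (hmem k).1 hv
      omega
  · rintro ⟨i, hi, hA, hv, hv'⟩ (_ | k)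
    · rw [pow_zero, rank_one, Fintype.card_fin]
      exact h0.symm
    · rw [rank_appendCol_pow_succ, hA (k + 1)]
      have hmem : v ∈ liftSpace A k ↔ ¬ k + 1 < f i := by
        constructor
        · intro h hk
          exact hv' k (by omega) h
        · intro h
          exact liftSpace_mono A (by omega) hv
      change _ = tailSum f M (k + 1)
      rw [tailSum_removeCell hi]
      change tailSum _ M (k + 1) + _ = _
      split_ifs <;> tauto

end LinearAlgebra

section Counting

open Module

variable {f : ℕ → ℕ} {n M i : ℕ}

/-- The polynomial counting the columns that extend a matrix of type `f` minus a corner in row `i`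
to a matrix of type `f`. -/
noncomputable def extensionPoly (f : ℕ → ℕ) (n M i : ℕ) : ℤ[X] :=
  X ^ (n + 1 - i) - if f i = 1 then 0 else X ^ (n - colLength (removeCell f i) M (f i - 2))

lemma IsBoundedPartition.le_of_mem_removables (hf : IsBoundedPartition f (n + 1) M)
    (hi : i ∈ removables f M) : i ≤ n + 1 := by
  have h1 := hf.colLength_removeCell hi
  have h2 := (hf.removeCell hi).colLength_le (f i - 1)
  omega

lemma extensionPoly_natDegree_le (hf : IsBoundedPartition f (n + 1) M)
    (hi : i ∈ removables f M) : (extensionPoly f n M i).natDegree ≤ n + 1 - i := by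
  have hi' := mem_removables.1 hi
  refine (natDegree_sub_le _ _).trans (max_le (natDegree_X_pow_le _) ?_)
  split_ifs with h
  · simp
  · have h1 := hf.le_colLength_removeCell hi (by omega)
    exact (natDegree_X_pow_le _).trans (by omega)

lemma extensionPoly_coeff (hf : IsBoundedPartition f (n + 1) M)
    (hi : i ∈ removables f M) : (extensionPoly f n M i).coeff (n + 1 - i) = 1 := by
  have hi' := mem_removables.1 hi
  rw [extensionPoly, coeff_sub, coeff_X_pow, if_pos rfl]
  split_ifs with h
  · simp
  · have h1 := hf.le_colLength_removeCell hi (by omega)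
    have h2 := (hf.removeCell hi).colLength_le (f i - 2)
    rw [coeff_X_pow, if_neg (by omega), sub_zero]

variable {F : Type} [Field F]

lemma finrank_liftSpace_add_colLength {A : Matrix (Fin n) (Fin n) F} (hA : HasJordanType A f M)
    (k : ℕ) : finrank F (liftSpace A k) + colLength f M k = n := by
  have h1 := finrank_liftSpace_add_rank A k
  have h2 := tailSum_eq_add_colLength f M k
  rw [hasJordanType_iff.1 hA, hasJordanType_iff.1 hA] at h1
  omega

lemma eq_of_hasJordanType_removeCell (hf : IsBoundedPartition f (n + 1) M) {j : ℕ}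
    (hi : i ∈ removables f M) (hj : j ∈ removables f M) {A : Matrix (Fin n) (Fin n) F}
    (hAi : HasJordanType A (removeCell f i) M) (hAj : HasJordanType A (removeCell f j) M) :
    i = j := by
  have key : ∀ k, k < f i ↔ k < f j := fun k => by
    have h1 := tailSum_removeCell hi k
    have h2 := tailSum_removeCell hj k
    rw [← hasJordanType_iff.1 hAi] at h1
    rw [← hasJordanType_iff.1 hAj] at h2
    split_ifs at h1 h2 <;> omega
  refine eq_of_mem_removables hf.anti hi hj (le_antisymm ?_ ?_)
  · exact le_of_forall_lt fun k hk => (key k).1 hk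
  · exact le_of_forall_lt fun k hk => (key k).2 hk

variable [Fintype F]

lemma natCard_submodule_eq {V : Type*} [AddCommGroup V] [Module F V] [Finite V]
    (p : Submodule F V) : Nat.card p = Fintype.card F ^ finrank F p := by
  have := Fintype.ofFinite p
  rw [Nat.card_eq_fintype_card, Module.card_eq_pow_finrank (K := F)]

lemma card_extensions (hf : IsBoundedPartition f (n + 1) M) (hi : i ∈ removables f M)
    {A : Matrix (Fin n) (Fin n) F} (hA : HasJordanType A (removeCell f i) M) :
    (Nat.card {v // v ∈ liftSpace A (f i - 1) ∧ ∀ j < f i - 1, v ∉ liftSpace A j} : ℤ) =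
      (extensionPoly f n M i).eval (Fintype.card F : ℤ) := by
  have hi' := mem_removables.1 hi
  have h1 := finrank_liftSpace_add_colLength hA (f i - 1)
  rw [hf.colLength_removeCell hi] at h1
  have h1' : finrank F (liftSpace A (f i - 1)) = n + 1 - i := by omega
  rw [extensionPoly, eval_sub, eval_pow, eval_X, ← h1']
  split_ifs with h
  · have : ∀ v, (v ∈ liftSpace A (f i - 1) ∧ ∀ j < f i - 1, v ∉ liftSpace A j) ↔
        v ∈ liftSpace A (f i - 1) := fun v => and_iff_left fun j hj => by omega
    simp only [this]
    rw [natCard_submodule_eq]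
    simp
  · have h2 := finrank_liftSpace_add_colLength hA (f i - 2)
    have h2' : n - colLength (removeCell f i) M (f i - 2) =
      finrank F (liftSpace A (f i - 2)) := by omega
    have hle := liftSpace_mono A (show f i - 2 ≤ f i - 1 by omega)
    have hset : {v | v ∈ liftSpace A (f i - 1) ∧ ∀ j < f i - 1, v ∉ liftSpace A j} =
        (liftSpace A (f i - 1) : Set (Fin n → F)) \ liftSpace A (f i - 2) := by
      ext v
      simp only [Set.mem_ofPred_eq, Set.mem_sdiff, SetLike.mem_coe]
      refine and_congr_right fun _ => ⟨fun h => h _ (by omega), fun h j hj hv => h ?_⟩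
      exact liftSpace_mono A (by omega) hv
    have hcard := Set.ncard_sdiff_add_ncard_of_subset (SetLike.coe_subset_coe.2 hle)
    rw [← hset, ← Nat.card_coe_set_eq, ← Nat.card_coe_set_eq, ← Nat.card_coe_set_eq] at hcard
    have e1 := natCard_submodule_eq (liftSpace A (f i - 1))
    have e2 := natCard_submodule_eq (liftSpace A (f i - 2))
    simp only [SetLike.coe_sort_coe] at hcard
    rw [e1, e2] at hcard
    rw [h2', eval_pow, eval_X, eq_sub_iff_add_eq]
    exact_mod_cast hcard

open Classical in
lemma card_columns (hf : IsBoundedPartition f (n + 1) M) (A : Matrix (Fin n) (Fin n) F) :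
    (Nat.card {v : Fin n → F // StrictUpper A ∧ HasJordanType (appendCol A v) f M} : ℤ) =
      ∑ i ∈ removables f M, if StrictUpper A ∧ HasJordanType A (removeCell f i) M then
        (extensionPoly f n M i).eval (Fintype.card F : ℤ) else 0 := by
  simp only [hasJordanType_appendCol_iff hf]
  by_cases hA : StrictUpper A ∧ ∃ i ∈ removables f M, HasJordanType A (removeCell f i) M
  · obtain ⟨hs, i, hi, hAi⟩ := hA
    have huniq : ∀ j ∈ removables f M, HasJordanType A (removeCell f j) M → j = i :=
      fun j hj hAj => eq_of_hasJordanType_removeCell hf hj hi hAj hAi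
    rw [Finset.sum_eq_single_of_mem i hi fun j hj hne =>
      if_neg fun h => hne (huniq j hj h.2), if_pos ⟨hs, hAi⟩, ← card_extensions hf hi hAi]
    congr 1
    refine Nat.card_congr (Equiv.subtypeEquivRight fun v => ?_)
    constructor
    · rintro ⟨-, j, hj, hAj, hv⟩
      rwa [huniq j hj hAj] at hv
    · exact fun hv => ⟨hs, i, hi, hAi, hv⟩
  · rw [Finset.sum_eq_zero fun i hi => if_neg fun h => hA ⟨h.1, i, hi, h.2⟩]
    have : IsEmpty {v : Fin n → F // StrictUpper A ∧ ∃ i ∈ removables f M,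
        HasJordanType A (removeCell f i) M ∧ v ∈ liftSpace A (f i - 1) ∧
          ∀ j < f i - 1, v ∉ liftSpace A j} :=
      ⟨fun ⟨_, h1, i, hi, h2, _⟩ => hA ⟨h1, i, hi, h2⟩⟩
    simp

lemma jordanCount_succ (hf : IsBoundedPartition f (n + 1) M) :
    (jordanCount (n + 1) f M F : ℤ) = ∑ i ∈ removables f M,
      (jordanCount n (removeCell f i) M F : ℤ) *
        (extensionPoly f n M i).eval (Fintype.card F : ℤ) := by
  classical
  rw [jordanCount, Nat.card_congr (strictUpperSuccEquiv f M), Nat.card_sigma, Nat.cast_sum]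
  simp only [card_columns hf]
  rw [Finset.sum_comm]
  refine Finset.sum_congr rfl fun i _ => ?_
  rw [← Finset.sum_filter, Finset.sum_const, nsmul_eq_mul, jordanCount, Nat.card_eq_fintype_card,
    Fintype.card_subtype]

lemma jordanCount_zero (hf : IsBoundedPartition f 0 M) : jordanCount 0 f M F = 1 := by
  rw [jordanCount, Nat.card_eq_one_iff_unique]
  refine ⟨inferInstance, ⟨0, fun i => i.elim0, fun k => ?_⟩⟩
  have h1 : tailSum f M k = 0 := Finset.sum_eq_zero fun i hi => by
    rw [Finset.sum_eq_zero_iff.1 hf.sum_eq i hi, Nat.zero_sub]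
  exact (Nat.le_zero.1 (Matrix.rank_le_height _)).trans h1.symm

end Counting

/-- The count of strictly upper triangular matrices of a given Jordan type is a polynomial in the
size of the field with leading coefficient the number of standard Young tableaux. -/
lemma IsBoundedPartition.exists_polynomial {f : ℕ → ℕ} {n M : ℕ}
    (hf : IsBoundedPartition f n M) :
    ∃ (Q : ℤ[X]) (D : ℕ), D + ∑ i ∈ Finset.Icc 1 M, (i - 1) * f i = n.choose 2 ∧
      Q.natDegree ≤ D ∧ Q.coeff D = sytCount n f ∧
        ∀ (F : Type) [Field F] [Fintype F],
          (jordanCount n f M F : ℤ) = Q.eval (Fintype.card F : ℤ) := by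
  induction n generalizing f with
  | zero =>
    refine ⟨1, 0, ?_, by simp, by simp [hf.sytCount_zero], fun F _ _ => by
      simp [jordanCount_zero hf]⟩
    rw [zero_add]
    exact Finset.sum_eq_zero fun i hi => by
      rw [Finset.sum_eq_zero_iff.1 hf.sum_eq i hi, mul_zero]
  | succ n ih =>
    choose! Q D hD hdeg hcoeff hcount using
      fun i (hi : i ∈ removables f M) => ih (hf.removeCell hi)
    have hstep : ∀ i ∈ removables f M,
        D i + (n + 1 - i) + ∑ k ∈ Finset.Icc 1 M, (k - 1) * f k = (n + 1).choose 2 := by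
      intro i hi
      have h1 := hD i hi
      have h2 := sum_removeCell hi fun k x => (k - 1) * x
      have h3 := hf.le_of_mem_removables hi
      have h4 := mem_removables.1 hi
      have h5 : (i - 1) * f i = (i - 1) * (f i - 1) + (i - 1) := by
        obtain ⟨c, hc⟩ : ∃ c, f i = c + 1 := ⟨f i - 1, by omega⟩
        rw [hc, Nat.add_sub_cancel]
        ring
      have h6 : (n + 1).choose 2 = n + n.choose 2 := by
        rw [Nat.choose_succ_succ' n 1, Nat.choose_one_right]
      omega
    obtain ⟨i₀, hi₀⟩ := hf.removables_nonempty
    have hD' : ∀ i ∈ removables f M, D i₀ + (n + 1 - i₀) = D i + (n + 1 - i) := fun i hi => by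
      have h1 := hstep i hi
      have h2 := hstep i₀ hi₀
      omega
    refine ⟨∑ i ∈ removables f M, Q i * extensionPoly f n M i, D i₀ + (n + 1 - i₀),
      hstep i₀ hi₀, ?_, ?_, fun F _ _ => ?_⟩
    · refine natDegree_sum_le_of_forall_le _ _ fun i hi => ?_
      rw [hD' i hi]
      exact natDegree_mul_le_of_le (hdeg i hi) (extensionPoly_natDegree_le hf hi)
    · rw [finsetSum_coeff, hf.sytCount_succ, Nat.cast_sum]
      refine Finset.sum_congr rfl fun i hi => ?_
      rw [hD' i hi, coeff_mul_add_eq_of_natDegree_le (hdeg i hi)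
        (extensionPoly_natDegree_le hf hi), hcoeff i hi, extensionPoly_coeff hf hi, mul_one]
    · rw [jordanCount_succ hf, eval_finsetSum]
      refine Finset.sum_congr rfl fun i hi => ?_
      rw [eval_mul, hcount i hi F]

theorem leadingCoeff_P (n N : ℕ) (f : ℕ → ℕ) (hf : IsPartitionFun f n N)
    (P : Polynomial ℤ)
    (hP : ∀ (F : Type) [Field F] [Fintype F],
      (jordanCount n f N F : ℤ) = P.eval (Fintype.card F : ℤ)) :
    P.leadingCoeff = (sytCount n f : ℤ) := by
  obtain ⟨Q, D, -, hdeg, hcoeff, hQ⟩ := hf.isBoundedPartition.exists_polynomial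
  have hPQ : P = Q := by
    refine eq_of_infinite_eval_eq P Q ?_
    refine (Nat.infinite_setOfPred_prime.image (f := ((↑) : ℕ → ℤ))
      Nat.cast_injective.injOn).mono ?_
    rintro _ ⟨p, hp, rfl⟩
    have : Fact p.Prime := ⟨hp⟩
    have h := (hP (ZMod p)).symm.trans (hQ (ZMod p))
    rwa [ZMod.card] at h
  have hpos := hf.isBoundedPartition.sytCount_pos
  have hne : Q.coeff D ≠ 0 := by
    rw [hcoeff]
    exact_mod_cast hpos.ne'
  rw [hPQ, leadingCoeff, le_antisymm hdeg (le_natDegree_of_ne_zero hne), hcoeff]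
end
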